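/- arXiv:1706.08816 — 2 statements merged into one kernel-verified Lean document; each statement's English description precedes it below -/
import Mathlib

section
/- Let d ≥ 2 be an integer, r purely imaginary. Then Ψ^d(r,−r,1) = 2^{1−d} · π^{−1} · Γ(d) · Γ((d+1)/2+3r) · Γ((d+1)/2−3r). -/
open Complex Real Set MeasureTheory Finset

/-- The beta function `B(u,v) = Γ(u)Γ(v)/Γ(u+v)`. -/
noncomputable def cBeta (u v : ℂ) : ℂ := Complex.Gamma u * Complex.Gamma v / Complex.Gamma (u + v)

/-- The completed Whittaker function `W^{d*}_{m'}(y, r)`, defined via its Mellin-Barnes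
integral with the contours placed at `σ₁ = σ₂ = 1`. -/
noncomputable def Wstar (d : ℕ) (r : ℂ) (y₁ y₂ : ℝ) (m' : ℤ) : ℂ :=
  ((2 : ℂ) ^ (d + 1) * (Real.pi : ℂ))⁻¹ *
    (Real.sqrt ((2 * d).choose (d + m'.natAbs)) : ℂ) *
    ∑ ℓ ∈ Finset.range (m'.natAbs + 1),
      (if 0 ≤ m' then (1 : ℂ) else -1) ^ ℓ * ((m'.natAbs).choose ℓ : ℂ) *
        (((2 * Real.pi : ℝ) : ℂ))⁻¹ ^ 2 *
          ∫ t : ℝ × ℝ,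
            ((2 * Real.pi * y₁ : ℝ) : ℂ) ^ (1 - ((1 : ℂ) + Complex.I * t.1)) *
              ((2 * Real.pi * y₂ : ℝ) : ℂ) ^ (1 - ((1 : ℂ) + Complex.I * t.2)) *
                Complex.Gamma (((d : ℂ) - 1) / 2 + ((1 : ℂ) + Complex.I * t.1) - r) *
                  Complex.Gamma (((d : ℂ) - 1) / 2 + ((1 : ℂ) + Complex.I * t.2) + r) *
                    cBeta (((d : ℂ) - (m'.natAbs : ℂ) + ((1 : ℂ) + Complex.I * t.1) + 2 * r) / 2)
                      (((ℓ : ℂ) + ((1 : ℂ) + Complex.I * t.2) - 2 * r) / 2)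

/-- The Rankin-Selberg local zeta integral `Ψ^d(r, r', t)`. -/
noncomputable def Psi (d : ℕ) (r r' t : ℂ) : ℂ :=
  ∫ y₁ in Set.Ioi (0 : ℝ), ∫ y₂ in Set.Ioi (0 : ℝ),
    (∑ m' ∈ Finset.Icc (-(d : ℤ)) (d : ℤ), Wstar d r y₁ y₂ m' * Wstar d r' y₁ y₂ m') *
      ((y₁ ^ 2 * y₂ : ℝ) : ℂ) ^ t / ((y₁ * y₂ : ℝ) : ℂ) ^ 3

theorem norm_Gamma_le_Gamma_re {s : ℂ} (hs : 0 < s.re) :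
    ‖Complex.Gamma s‖ ≤ Real.Gamma s.re := by
  rw [Complex.Gamma_eq_integral hs, Real.Gamma_eq_integral hs, Complex.GammaIntegral]
  refine (norm_integral_le_integral_norm _).trans_eq
    (setIntegral_congr_fun measurableSet_Ioi fun x hx ↦ ?_)
  have hx : 0 < x := hx
  simp only [norm_mul, Complex.norm_real, Complex.norm_cpow_eq_rpow_re_of_pos hx]
  simp

theorem continuous_Gamma_line {a : ℂ} (ha : 0 < a.re) :
    Continuous fun t : ℝ ↦ Complex.Gamma (a + Complex.I * t) := by
  rw [continuous_iff_continuousAt]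
  intro t
  refine ContinuousAt.comp (g := Complex.Gamma) (Complex.differentiableAt_Gamma _ fun m h ↦ ?_).continuousAt
    (by fun_prop)
  have := congrArg Complex.re h
  simp at this
  have : (0 : ℝ) ≤ m := by positivity
  linarith

theorem integrable_Gamma_line {a : ℂ} (ha : 1 ≤ a.re) :
    Integrable fun t : ℝ ↦ Complex.Gamma (a + Complex.I * t) := by
  have key : Integrable fun t : ℝ ↦ Real.Gamma (a.re + 2) * (1 + (t + a.im) ^ 2)⁻¹ :=
    (integrable_inv_one_add_sq.comp_add_right a.im).const_mul _
  refine key.mono' (continuous_Gamma_line (by linarith)).aestronglyMeasurable (.of_forall fun t ↦ ?_)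
  set s := a + Complex.I * t with hs
  have hre : s.re = a.re := by simp [hs]
  have him : s.im = t + a.im := by simp [hs, add_comm]
  have h0 : s ≠ 0 := fun h ↦ by rw [h] at hre; simp at hre; linarith
  have h1 : s + 1 ≠ 0 := fun h ↦ by
    have := congrArg Complex.re h
    simp at this; linarith
  have hG : Complex.Gamma (s + 2) = (s + 1) * (s * Complex.Gamma s) := by
    rw [← Complex.Gamma_add_one s h0, ← Complex.Gamma_add_one _ h1]
    ring_nf
  have hb : ‖Complex.Gamma (s + 2)‖ ≤ Real.Gamma (a.re + 2) := by
    have := norm_Gamma_le_Gamma_re (s := s + 2) (by simp; linarith)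
    simpa [hre] using this
  rw [hG, norm_mul, norm_mul] at hb
  have hs2 : 1 + (t + a.im) ^ 2 ≤ ‖s‖ ^ 2 := by
    rw [← Complex.normSq_eq_norm_sq, Complex.normSq_apply, hre, him]
    nlinarith
  have hs3 : ‖s‖ ≤ ‖s + 1‖ := by
    rw [← sq_le_sq₀ (norm_nonneg _) (norm_nonneg _), ← Complex.normSq_eq_norm_sq,
      ← Complex.normSq_eq_norm_sq, Complex.normSq_apply, Complex.normSq_apply]
    simp [hre]
    nlinarith
  rw [← div_eq_mul_inv, le_div_iff₀ (by positivity)]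
  refine le_trans ?_ hb
  calc ‖Complex.Gamma s‖ * (1 + (t + a.im) ^ 2) ≤ ‖Complex.Gamma s‖ * (‖s‖ * ‖s‖) := by
        gcongr; nlinarith
    _ ≤ ‖Complex.Gamma s‖ * (‖s + 1‖ * ‖s‖) := by gcongr
    _ = _ := by ring

theorem integral_cpow_mul_Gamma_line {a : ℂ} (ha : 1 ≤ a.re) {X : ℝ} (hX : 0 < X) :
    ∫ t : ℝ, (X : ℂ) ^ (-(Complex.I * t)) * Complex.Gamma (a + Complex.I * t) =
      2 * π * ((X : ℂ) ^ a * Real.exp (-X)) := by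
  set f : ℝ → ℂ := fun x ↦ (x : ℂ) ^ a * Real.exp (-x) with hf
  have hm : ∀ t : ℝ, mellin f (t * Complex.I) = Complex.Gamma (a + Complex.I * t) := by
    intro t
    rw [Complex.Gamma_eq_integral (by simp; linarith), Complex.GammaIntegral, mellin]
    refine setIntegral_congr_fun measurableSet_Ioi fun x hx ↦ ?_
    have hx : (x : ℂ) ≠ 0 := Complex.ofReal_ne_zero.2 (ne_of_gt hx)
    simp only [hf, smul_eq_mul]
    rw [← mul_assoc, ← Complex.cpow_add _ _ hx, mul_comm]
    congr 2
    ring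
  have hc : MellinConvergent f ((0 : ℝ) : ℂ) := by
    refine (Complex.GammaIntegral_convergent (s := a) (by linarith)).congr_fun (fun x hx ↦ ?_)
      measurableSet_Ioi
    have hx : (x : ℂ) ≠ 0 := Complex.ofReal_ne_zero.2 (ne_of_gt hx)
    simp only [hf, smul_eq_mul]
    rw [← mul_assoc, ← Complex.cpow_add _ _ hx, mul_comm]
    congr 2
    simp; ring
  have hv : VerticalIntegrable (mellin f) 0 := by
    refine (integrable_Gamma_line ha).congr (.of_forall fun t ↦ ?_)
    simp [hm]
  have hca : ContinuousAt f X :=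
    (Complex.continuousAt_ofReal_cpow_const _ _ (Or.inr hX.ne')).mul (by fun_prop)
  have := mellinInv_mellin_eq 0 f hX hc hv hca
  simp only [mellinInv, smul_eq_mul, Complex.ofReal_zero, zero_add, hm] at this
  have hpi : (π : ℂ) ≠ 0 := by exact_mod_cast Real.pi_ne_zero
  change _ = 2 * π * f X
  rw [← this, Complex.real_smul]
  simp only [mul_comm _ Complex.I]
  push_cast
  field_simp

theorem integral_Ioi_beta {u v : ℂ} (hu : 0 < u.re) (hv : 0 < v.re) :
    ∫ x in Set.Ioi (0 : ℝ), (x : ℂ) ^ (v - 1) * ((1 + x : ℝ) : ℂ) ^ (-(u + v)) = cBeta u v := by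
  have himg : (fun x : ℝ ↦ x / (1 + x)) '' Set.Ioi 0 = Set.Ioo 0 1 := by
    ext y
    simp only [Set.mem_image, Set.mem_Ioi, Set.mem_Ioo]
    constructor
    · rintro ⟨x, hx, rfl⟩
      exact ⟨by positivity, by rw [div_lt_one (by positivity)]; linarith⟩
    · rintro ⟨h0, h1⟩
      have : 0 < 1 - y := by linarith
      exact ⟨y / (1 - y), by positivity, by field_simp; ring⟩
  have hinj : Set.InjOn (fun x : ℝ ↦ x / (1 + x)) (Set.Ioi 0) := by
    intro x hx y hy h
    have hx : 0 < x := hx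
    have hy : 0 < y := hy
    simp only at h
    rw [div_eq_div_iff (by positivity) (by positivity)] at h
    linarith
  have hd : ∀ x ∈ Set.Ioi (0 : ℝ), HasDerivWithinAt (fun x : ℝ ↦ x / (1 + x))
      (((1 + x) ^ 2)⁻¹) (Set.Ioi 0) x := by
    intro x hx
    have hx : 0 < x := hx
    have h := (hasDerivAt_id x).div ((hasDerivAt_id x).const_add 1) (by simp; positivity)
    refine (h.congr_deriv ?_).hasDerivWithinAt
    simp only [id]
    field_simp
    ring
  have := integral_image_eq_integral_abs_deriv_smul measurableSet_Ioi hd hinj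
    (fun x : ℝ ↦ (x : ℂ) ^ (v - 1) * (1 - (x : ℂ)) ^ (u - 1))
  rw [himg, ← integral_Ioc_eq_integral_Ioo,
    ← intervalIntegral.integral_of_le zero_le_one] at this
  have hb : Complex.betaIntegral v u = cBeta u v := by
    rw [Complex.betaIntegral_eq_Gamma_mul_div _ _ hv hu, cBeta, mul_comm, add_comm]
  rw [← hb, Complex.betaIntegral, this]
  refine setIntegral_congr_fun measurableSet_Ioi fun x hx ↦ ?_
  have hx : 0 < x := hx
  have h1 : (0 : ℝ) < 1 + x := by positivity
  have h1c : ((1 + x : ℝ) : ℂ) ≠ 0 := Complex.ofReal_ne_zero.2 h1.ne'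
  have e1 : (1 : ℂ) - ((x / (1 + x) : ℝ) : ℂ) = (((1 + x)⁻¹ : ℝ) : ℂ) := by
    rw [← Complex.ofReal_one, ← Complex.ofReal_sub]
    congr 1
    field_simp
    ring
  rw [e1, abs_of_pos (by positivity), Complex.real_smul, Complex.ofReal_div,
    Complex.div_cpow_ofReal_nonneg hx.le h1.le, Complex.ofReal_inv,
    Complex.ofReal_inv, Complex.inv_cpow _ _ (by rw [Complex.arg_ofReal_of_nonneg h1.le]; exact Real.pi_pos.ne)]
  rw [Complex.ofReal_pow, ← Complex.cpow_natCast, ← Complex.cpow_neg,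
    ← Complex.cpow_neg, div_eq_mul_inv, ← Complex.cpow_neg]
  rw [show -(u + v) = -((2 : ℕ) : ℂ) + -(v - 1) + -(u - 1) by push_cast; ring,
    Complex.cpow_add _ _ h1c, Complex.cpow_add _ _ h1c]
  ring

theorem integral_Ioi_beta_sq {u v : ℂ} (hu : 0 < u.re) (hv : 0 < v.re) :
    ∫ x in Set.Ioi (0 : ℝ), 2 * ((x : ℂ) ^ (2 * v - 1) * ((1 + x ^ 2 : ℝ) : ℂ) ^ (-(u + v))) =
      cBeta u v := by
  rw [← integral_Ioi_beta hu hv, ← integral_comp_rpow_Ioi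
    (fun x : ℝ ↦ (x : ℂ) ^ (v - 1) * ((1 + x : ℝ) : ℂ) ^ (-(u + v))) two_ne_zero]
  refine setIntegral_congr_fun measurableSet_Ioi fun x hx ↦ ?_
  have hx : 0 < x := hx
  have hxc : (x : ℂ) ≠ 0 := Complex.ofReal_ne_zero.2 hx.ne'
  have e : ((x ^ (2 : ℝ) : ℝ) : ℂ) ^ (v - 1) = (x : ℂ) ^ (2 * (v - 1)) := by
    rw [Real.rpow_two, sq, Complex.ofReal_mul, Complex.mul_cpow_ofReal_nonneg hx.le hx.le,
      ← Complex.cpow_add _ _ hxc, two_mul]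
  simp only [Complex.real_smul]
  rw [e, Real.rpow_two, show 2 * v - 1 = 1 + 2 * (v - 1) by ring, Complex.cpow_add _ _ hxc]
  norm_num
  ring

/-- The length of the hypotenuse over the legs `1` and `x`. -/
noncomputable def hyp (x : ℝ) : ℝ := √(1 + x ^ 2)

theorem hyp_pos (x : ℝ) : 0 < hyp x := Real.sqrt_pos.2 (by positivity)

theorem hyp_sq (x : ℝ) : hyp x ^ 2 = 1 + x ^ 2 := Real.sq_sqrt (by positivity)

theorem lt_hyp (x : ℝ) : x < hyp x := by
  have := hyp_pos x
  nlinarith [hyp_sq x]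

@[fun_prop]
theorem continuous_hyp : Continuous hyp := by
  unfold hyp
  fun_prop

@[fun_prop]
theorem measurable_hyp : Measurable hyp := continuous_hyp.measurable

theorem norm_cpow_of_re_eq_zero {x : ℝ} (hx : 0 < x) {s : ℂ} (hs : s.re = 0) :
    ‖(x : ℂ) ^ s‖ = 1 := by
  rw [Complex.norm_cpow_eq_rpow_re_of_pos hx, hs, Real.rpow_zero]

theorem integrableOn_pow_mul_inv_hyp_pow (n ℓ : ℕ) :
    IntegrableOn (fun x ↦ x ^ ℓ * (hyp x ^ (n + ℓ + 2))⁻¹) (Set.Ioi 0) := by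
  refine integrable_inv_one_add_sq.integrableOn.mono' ?_ ?_
  · exact Measurable.aestronglyMeasurable (by fun_prop)
  · refine (ae_restrict_iff' measurableSet_Ioi).2 (.of_forall fun x hx ↦ ?_)
    have hx : 0 < x := hx
    have h0 := hyp_pos x
    have h1 : 1 ≤ hyp x := by nlinarith [hyp_sq x]
    rw [Real.norm_of_nonneg (by positivity), ← hyp_sq, ← div_eq_mul_inv,
      div_le_iff₀ (by positivity)]
    calc x ^ ℓ ≤ hyp x ^ ℓ := by gcongr; exact (lt_hyp x).le
      _ ≤ hyp x ^ (n + ℓ) := pow_le_pow_right₀ h1 (by omega)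
      _ = _ := by field_simp; ring

/-- The integrand of the beta integral in the Mellin-Barnes representation, after pairing its
factors with the two Gamma lines. -/
noncomputable def mellinBarnesKernel (a₁ a₂ r : ℂ) (n ℓ : ℕ) (Y₁ Y₂ : ℝ) (p : (ℝ × ℝ) × ℝ) : ℂ :=
  ((2 * (p.2 ^ ℓ * (hyp p.2 ^ (n + ℓ + 2))⁻¹) : ℝ) : ℂ) * (p.2 : ℂ) ^ (-2 * r) *
    ((((Y₁ * hyp p.2 : ℝ) : ℂ) ^ (-(Complex.I * p.1.1)) * Complex.Gamma (a₁ + Complex.I * p.1.1)) *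
     (((Y₂ * hyp p.2 / p.2 : ℝ) : ℂ) ^ (-(Complex.I * p.1.2)) *
        Complex.Gamma (a₂ + Complex.I * p.1.2)))

theorem integrable_mellinBarnesKernel {a₁ a₂ r : ℂ} (h₁ : 1 ≤ a₁.re) (h₂ : 1 ≤ a₂.re)
    (hr : r.re = 0) (n ℓ : ℕ) {Y₁ Y₂ : ℝ} (hY₁ : 0 < Y₁) (hY₂ : 0 < Y₂) :
    Integrable (mellinBarnesKernel a₁ a₂ r n ℓ Y₁ Y₂)
      ((volume : Measure (ℝ × ℝ)).prod (volume.restrict (Set.Ioi 0))) := by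
  have m₁ := (continuous_Gamma_line (a := a₁) (by linarith)).measurable
  have m₂ := (continuous_Gamma_line (a := a₂) (by linarith)).measurable
  have hb := ((integrable_Gamma_line h₁).norm.mul_prod (integrable_Gamma_line h₂).norm).mul_prod
    ((integrableOn_pow_mul_inv_hyp_pow n ℓ).const_mul 2)
  refine hb.mono' (Measurable.aestronglyMeasurable ?_) ?_
  · have e₁ : Measurable fun p : (ℝ × ℝ) × ℝ ↦ Complex.Gamma (a₁ + Complex.I * p.1.1) :=
      m₁.comp (measurable_fst.comp measurable_fst)
    have e₂ : Measurable fun p : (ℝ × ℝ) × ℝ ↦ Complex.Gamma (a₂ + Complex.I * p.1.2) :=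
      m₂.comp (measurable_snd.comp measurable_fst)
    unfold mellinBarnesKernel
    fun_prop
  · have hpos : ∀ᵐ p : (ℝ × ℝ) × ℝ ∂(volume.prod (volume.restrict (Set.Ioi 0))), 0 < p.2 :=
      Measure.quasiMeasurePreserving_snd.ae
        ((ae_restrict_iff' measurableSet_Ioi).2 (.of_forall fun x hx ↦ hx))
    filter_upwards [hpos] with p hp
    have h0 := hyp_pos p.2
    rw [mellinBarnesKernel]
    simp only [norm_mul, Complex.norm_real]
    rw [norm_cpow_of_re_eq_zero hp (by simp [hr]), norm_cpow_of_re_eq_zero (by positivity) (by simp),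
      norm_cpow_of_re_eq_zero (by positivity) (by simp), Real.norm_of_nonneg (by positivity)]
    rw [Real.norm_of_nonneg (by positivity), Real.norm_of_nonneg (by positivity)]
    apply le_of_eq
    ring

theorem integral_mellinBarnesKernel_left {a₁ a₂ : ℂ} (h₁ : 1 ≤ a₁.re) (h₂ : 1 ≤ a₂.re)
    (r : ℂ) (n ℓ : ℕ) {Y₁ Y₂ x : ℝ} (hY₁ : 0 < Y₁) (hY₂ : 0 < Y₂) (hx : 0 < x) :
    ∫ t : ℝ × ℝ, mellinBarnesKernel a₁ a₂ r n ℓ Y₁ Y₂ (t, x) =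
      (2 * π) ^ 2 * (((2 * (x ^ ℓ * (hyp x ^ (n + ℓ + 2))⁻¹) : ℝ) : ℂ) * (x : ℂ) ^ (-2 * r) *
        ((((Y₁ * hyp x : ℝ) : ℂ) ^ a₁ * Real.exp (-(Y₁ * hyp x))) *
          (((Y₂ * hyp x / x : ℝ) : ℂ) ^ a₂ * Real.exp (-(Y₂ * hyp x / x))))) := by
  have h0 := hyp_pos x
  simp only [mellinBarnesKernel]
  rw [integral_const_mul, Measure.volume_eq_prod, integral_prod_mul
    (fun t : ℝ ↦ ((Y₁ * hyp x : ℝ) : ℂ) ^ (-(Complex.I * t)) * Complex.Gamma (a₁ + Complex.I * t))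
    (fun t : ℝ ↦ ((Y₂ * hyp x / x : ℝ) : ℂ) ^ (-(Complex.I * t)) *
      Complex.Gamma (a₂ + Complex.I * t)),
    integral_cpow_mul_Gamma_line h₁ (by positivity), integral_cpow_mul_Gamma_line h₂ (by positivity)]
  ring

theorem integral_mellinBarnesKernel_right {a₁ a₂ r : ℂ} (hr : r.re = 0)
    (n ℓ : ℕ) {Y₁ Y₂ : ℝ} (hY₁ : 0 < Y₁) (hY₂ : 0 < Y₂) (t : ℝ × ℝ) :
    ∫ x in Set.Ioi 0, mellinBarnesKernel a₁ a₂ r n ℓ Y₁ Y₂ (t, x) =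
      (Y₁ : ℂ) ^ (-(Complex.I * t.1)) * (Y₂ : ℂ) ^ (-(Complex.I * t.2)) *
        Complex.Gamma (a₁ + Complex.I * t.1) * Complex.Gamma (a₂ + Complex.I * t.2) *
          cBeta (((n : ℂ) + (1 + Complex.I * t.1) + 2 * r) / 2)
            (((ℓ : ℂ) + (1 + Complex.I * t.2) - 2 * r) / 2) := by
  rw [← integral_Ioi_beta_sq (by simp [hr]; positivity) (by simp [hr]; positivity),
    ← integral_const_mul]
  refine setIntegral_congr_fun measurableSet_Ioi fun x hx ↦ ?_
  have hx : 0 < x := hx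
  have h0 := hyp_pos x
  have hxc : (x : ℂ) ≠ 0 := Complex.ofReal_ne_zero.2 hx.ne'
  have h0c : (hyp x : ℂ) ≠ 0 := Complex.ofReal_ne_zero.2 h0.ne'
  simp only [mellinBarnesKernel]
  rw [Complex.ofReal_div, Complex.div_cpow_ofReal_nonneg (by positivity) hx.le,
    Complex.ofReal_mul Y₁, Complex.ofReal_mul Y₂,
    Complex.mul_cpow_ofReal_nonneg hY₁.le h0.le, Complex.mul_cpow_ofReal_nonneg hY₂.le h0.le,
    ← hyp_sq x, sq, Complex.ofReal_mul (hyp x),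
    Complex.mul_cpow_ofReal_nonneg h0.le h0.le, ← Complex.cpow_add _ _ h0c]
  have e1 : (x : ℂ) ^ (2 * (((ℓ : ℂ) + (1 + Complex.I * t.2) - 2 * r) / 2) - 1) =
      (x : ℂ) ^ ℓ * (x : ℂ) ^ (-2 * r) / (x : ℂ) ^ (-(Complex.I * t.2)) := by
    rw [← Complex.cpow_natCast, ← Complex.cpow_add _ _ hxc, ← Complex.cpow_sub _ _ hxc]
    congr 1
    ring
  have e2 : ∀ w : ℂ, w = (((n + ℓ + 2 : ℕ) : ℂ) + Complex.I * t.1 + Complex.I * t.2) / 2 →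
      (hyp x : ℂ) ^ (-w + -w) = ((hyp x : ℂ) ^ (n + ℓ + 2))⁻¹ *
        ((hyp x : ℂ) ^ (-(Complex.I * t.1)) * (hyp x : ℂ) ^ (-(Complex.I * t.2))) := by
    rintro z rfl
    rw [← Complex.cpow_natCast, ← Complex.cpow_neg, ← Complex.cpow_add _ _ h0c,
      ← Complex.cpow_add _ _ h0c]
    ring_nf
  rw [e1, e2 _ (by push_cast; ring)]
  push_cast
  ring

/-- The value of the Mellin-Barnes integral as a one-dimensional integral, with its convergence. -/
theorem integral_Gamma_mul_Gamma_mul_cBeta {a₁ a₂ r : ℂ} (h₁ : 1 ≤ a₁.re) (h₂ : 1 ≤ a₂.re)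
    (hr : r.re = 0) (n ℓ : ℕ) {Y₁ Y₂ : ℝ} (hY₁ : 0 < Y₁) (hY₂ : 0 < Y₂) :
    IntegrableOn (fun x : ℝ ↦ ((2 * (x ^ ℓ * (hyp x ^ (n + ℓ + 2))⁻¹) : ℝ) : ℂ) *
      (x : ℂ) ^ (-2 * r) * ((((Y₁ * hyp x : ℝ) : ℂ) ^ a₁ * Real.exp (-(Y₁ * hyp x))) *
          (((Y₂ * hyp x / x : ℝ) : ℂ) ^ a₂ * Real.exp (-(Y₂ * hyp x / x))))) (Set.Ioi 0) ∧
    ((2 * π : ℝ) : ℂ)⁻¹ ^ 2 * ∫ t : ℝ × ℝ,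
      (Y₁ : ℂ) ^ (-(Complex.I * t.1)) * (Y₂ : ℂ) ^ (-(Complex.I * t.2)) *
        Complex.Gamma (a₁ + Complex.I * t.1) * Complex.Gamma (a₂ + Complex.I * t.2) *
          cBeta (((n : ℂ) + (1 + Complex.I * t.1) + 2 * r) / 2)
            (((ℓ : ℂ) + (1 + Complex.I * t.2) - 2 * r) / 2) =
    ∫ x in Set.Ioi (0 : ℝ), ((2 * (x ^ ℓ * (hyp x ^ (n + ℓ + 2))⁻¹) : ℝ) : ℂ) *
      (x : ℂ) ^ (-2 * r) * ((((Y₁ * hyp x : ℝ) : ℂ) ^ a₁ * Real.exp (-(Y₁ * hyp x))) *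
          (((Y₂ * hyp x / x : ℝ) : ℂ) ^ a₂ * Real.exp (-(Y₂ * hyp x / x)))) := by
  have hI := integrable_mellinBarnesKernel h₁ h₂ hr n ℓ hY₁ hY₂
  have hcongr : ∀ x ∈ Set.Ioi (0 : ℝ), ((2 * π : ℝ) : ℂ)⁻¹ ^ 2 *
      ∫ t : ℝ × ℝ, mellinBarnesKernel a₁ a₂ r n ℓ Y₁ Y₂ (t, x) = _ := fun x hx ↦ by
    rw [integral_mellinBarnesKernel_left h₁ h₂ r n ℓ hY₁ hY₂ hx, ← mul_assoc, Complex.ofReal_mul,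
      Complex.ofReal_ofNat, ← mul_pow, inv_mul_cancel₀ (by simp), one_pow, one_mul]
  constructor
  · exact IntegrableOn.congr_fun (hI.integral_prod_right.const_mul _) hcongr measurableSet_Ioi
  · rw [← setIntegral_congr_fun measurableSet_Ioi hcongr, integral_const_mul]
    simp_rw [← integral_mellinBarnesKernel_right hr n ℓ hY₁ hY₂]
    rw [integral_integral_swap (f := fun t x ↦ mellinBarnesKernel a₁ a₂ r n ℓ Y₁ Y₂ (t, x)) hI]

theorem sum_choose_mul_pow_div_hyp_pow {d : ℕ} {m' : ℤ} (hm : m'.natAbs ≤ d) (x : ℝ) :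
    ∑ ℓ ∈ Finset.range (m'.natAbs + 1), (if 0 ≤ m' then (1 : ℝ) else -1) ^ ℓ *
      (m'.natAbs.choose ℓ : ℝ) * (x ^ ℓ * (hyp x ^ (d - m'.natAbs + ℓ + 2))⁻¹) =
    (hyp x + x) ^ m' * (hyp x ^ (d + 2))⁻¹ := by
  have h0 := hyp_pos x
  have hbinom : ((if 0 ≤ m' then (1 : ℝ) else -1) * x + hyp x) ^ m'.natAbs = (hyp x + x) ^ m' := by
    split_ifs with h
    · lift m' to ℕ using h
      simp [add_comm]
    · obtain ⟨k, rfl⟩ : ∃ k : ℕ, m' = -k := ⟨m'.natAbs, by omega⟩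
      have : hyp x - x = (hyp x + x)⁻¹ := by
        refine eq_inv_of_mul_eq_one_left ?_
        linear_combination hyp_sq x
      rw [Int.natAbs_neg, Int.natAbs_natCast, zpow_neg, zpow_natCast, ← inv_pow, ← this]
      ring
  rw [← hbinom, add_pow, Finset.sum_mul]
  refine Finset.sum_congr rfl fun ℓ hℓ ↦ ?_
  have hℓ : ℓ ≤ m'.natAbs := by simpa [Nat.lt_succ_iff] using hℓ
  have : hyp x ^ (d + 2) = hyp x ^ (d - m'.natAbs + ℓ + 2) * hyp x ^ (m'.natAbs - ℓ) := by
    rw [← pow_add]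
    congr 1
    omega
  rw [this, mul_pow]
  field_simp

/-- The integrand of a one-dimensional integral representation of `Wstar`. -/
noncomputable def whittakerKernel (d : ℕ) (r : ℂ) (y₁ y₂ : ℝ) (m' : ℤ) (x : ℝ) : ℂ :=
  (((hyp x + x) ^ m' * (hyp x)⁻¹ * (Real.exp (-(2 * π * y₁ * hyp x)) *
    Real.exp (-(2 * π * y₂ * hyp x / x))) : ℝ) : ℂ) * (x : ℂ) ^ (-(((d : ℂ) + 1) / 2 + 3 * r))

theorem Wstar_eq_integral_whittakerKernel {d : ℕ} (hd : 1 ≤ d) {r : ℂ} (hr : r.re = 0) {y₁ y₂ : ℝ}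
    (hy₁ : 0 < y₁) (hy₂ : 0 < y₂) {m' : ℤ} (hm : m'.natAbs ≤ d) :
    IntegrableOn (whittakerKernel d r y₁ y₂ m') (Set.Ioi 0) ∧
    Wstar d r y₁ y₂ m' = ((2 : ℂ) ^ d * π)⁻¹ * (√((2 * d).choose (d + m'.natAbs)) : ℂ) *
      (((2 * π * y₁ : ℝ) : ℂ) ^ (((d : ℂ) + 1) / 2 - r) *
        ((2 * π * y₂ : ℝ) : ℂ) ^ (((d : ℂ) + 1) / 2 + r)) *
      ∫ x in Set.Ioi 0, whittakerKernel d r y₁ y₂ m' x := by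
  have hd' : (1 : ℝ) ≤ d := by exact_mod_cast hd
  have h₁ : 1 ≤ (((d : ℂ) + 1) / 2 - r).re := by simp [hr]; linarith
  have h₂ : 1 ≤ (((d : ℂ) + 1) / 2 + r).re := by simp [hr]; linarith
  have hY₁ : 0 < 2 * π * y₁ := by positivity
  have hY₂ : 0 < 2 * π * y₂ := by positivity
  have hMB := fun ℓ : ℕ ↦
    integral_Gamma_mul_Gamma_mul_cBeta h₁ h₂ hr (d - m'.natAbs) ℓ hY₁ hY₂
  set a₁ := ((d : ℂ) + 1) / 2 - r with ha₁
  set a₂ := ((d : ℂ) + 1) / 2 + r with ha₂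
  set Y₁ := 2 * π * y₁ with hY₁_def
  set Y₂ := 2 * π * y₂ with hY₂_def
  have hA : (2 : ℂ) * ((Y₁ : ℂ) ^ a₁ * (Y₂ : ℂ) ^ a₂) ≠ 0 := by
    simp [Complex.cpow_eq_zero_iff, hY₁.ne', hY₂.ne']
  have hsum : ∀ x ∈ Set.Ioi (0 : ℝ), ∑ ℓ ∈ Finset.range (m'.natAbs + 1),
      ((if 0 ≤ m' then (1 : ℂ) else -1) ^ ℓ * (m'.natAbs.choose ℓ : ℂ)) *
        (((2 * (x ^ ℓ * (hyp x ^ (d - m'.natAbs + ℓ + 2))⁻¹) : ℝ) : ℂ) *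
          (x : ℂ) ^ (-2 * r) * ((((Y₁ * hyp x : ℝ) : ℂ) ^ a₁ * Real.exp (-(Y₁ * hyp x))) *
          (((Y₂ * hyp x / x : ℝ) : ℂ) ^ a₂ * Real.exp (-(Y₂ * hyp x / x))))) =
      (2 * ((Y₁ : ℂ) ^ a₁ * (Y₂ : ℂ) ^ a₂)) * whittakerKernel d r y₁ y₂ m' x := by
    intro x hx
    have hx : 0 < x := hx
    have h0 := hyp_pos x
    have hxc : (x : ℂ) ≠ 0 := Complex.ofReal_ne_zero.2 hx.ne'
    have h0c : (hyp x : ℂ) ≠ 0 := Complex.ofReal_ne_zero.2 h0.ne'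
    have hs := congrArg Complex.ofReal (sum_choose_mul_pow_div_hyp_pow hm x)
    have hif : (((if 0 ≤ m' then (1 : ℝ) else -1) : ℝ) : ℂ) = if 0 ≤ m' then (1 : ℂ) else -1 := by
      split_ifs <;> simp
    have e1 : ((Y₁ * hyp x : ℝ) : ℂ) ^ a₁ * ((Y₂ * hyp x / x : ℝ) : ℂ) ^ a₂ * (x : ℂ) ^ (-2 * r) =
        (Y₁ : ℂ) ^ a₁ * (Y₂ : ℂ) ^ a₂ * ((hyp x : ℂ) ^ (d + 1) *
          (x : ℂ) ^ (-(((d : ℂ) + 1) / 2 + 3 * r))) := by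
      rw [Complex.ofReal_div, Complex.div_cpow_ofReal_nonneg (by positivity) hx.le,
        Complex.ofReal_mul Y₁, Complex.ofReal_mul Y₂, Complex.mul_cpow_ofReal_nonneg hY₁.le h0.le,
        Complex.mul_cpow_ofReal_nonneg hY₂.le h0.le, ← Complex.cpow_natCast,
        show ((d + 1 : ℕ) : ℂ) = a₁ + a₂ by rw [ha₁, ha₂]; push_cast; ring,
        Complex.cpow_add a₁ a₂ h0c,
        show -(((d : ℂ) + 1) / 2 + 3 * r) = -a₂ + -2 * r by rw [ha₂]; ring,
        Complex.cpow_add (-a₂) (-2 * r) hxc, Complex.cpow_neg _ a₂]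
      ring
    have e2 : ∀ ℓ : ℕ, ((if 0 ≤ m' then (1 : ℂ) else -1) ^ ℓ * (m'.natAbs.choose ℓ : ℂ)) *
        (((2 * (x ^ ℓ * (hyp x ^ (d - m'.natAbs + ℓ + 2))⁻¹) : ℝ) : ℂ) *
          (x : ℂ) ^ (-2 * r) * ((((Y₁ * hyp x : ℝ) : ℂ) ^ a₁ * Real.exp (-(Y₁ * hyp x))) *
          (((Y₂ * hyp x / x : ℝ) : ℂ) ^ a₂ * Real.exp (-(Y₂ * hyp x / x))))) =
        (((if 0 ≤ m' then (1 : ℝ) else -1) ^ ℓ * (m'.natAbs.choose ℓ : ℝ) *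
          (x ^ ℓ * (hyp x ^ (d - m'.natAbs + ℓ + 2))⁻¹) : ℝ) : ℂ) *
        (2 * (((Y₁ * hyp x : ℝ) : ℂ) ^ a₁ * ((Y₂ * hyp x / x : ℝ) : ℂ) ^ a₂ * (x : ℂ) ^ (-2 * r)) *
          (Real.exp (-(Y₁ * hyp x)) * Real.exp (-(Y₂ * hyp x / x)))) := by
      intro ℓ
      rw [← hif, Complex.ofReal_mul 2, Complex.ofReal_mul (_ * _) (_ * _),
        Complex.ofReal_mul (_ ^ _) (Nat.cast _), Complex.ofReal_pow, Complex.ofReal_natCast,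
        Complex.ofReal_ofNat]
      ring
    simp_rw [e2]
    rw [← Finset.sum_mul, ← Complex.ofReal_sum, hs, e1, whittakerKernel, ← hY₁_def, ← hY₂_def]
    push_cast
    field_simp
    ring
  constructor
  · have hI : IntegrableOn (fun x ↦ (2 * ((Y₁ : ℂ) ^ a₁ * (Y₂ : ℂ) ^ a₂)) *
        whittakerKernel d r y₁ y₂ m' x) (Set.Ioi 0) :=
      IntegrableOn.congr_fun (integrable_finsetSum _ fun ℓ _ ↦ (hMB ℓ).1.const_mul _) hsum
        measurableSet_Ioi
    refine (hI.const_mul (2 * ((Y₁ : ℂ) ^ a₁ * (Y₂ : ℂ) ^ a₂))⁻¹).congr (.of_forall fun x ↦ ?_)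
    simp only
    rw [← mul_assoc, inv_mul_cancel₀ hA, one_mul]
  · have hW : ∑ ℓ ∈ Finset.range (m'.natAbs + 1),
        ((if 0 ≤ m' then (1 : ℂ) else -1) ^ ℓ * (m'.natAbs.choose ℓ : ℂ)) *
        (((2 * π : ℝ) : ℂ)⁻¹ ^ 2 * ∫ t : ℝ × ℝ,
          (Y₁ : ℂ) ^ (-(Complex.I * t.1)) * (Y₂ : ℂ) ^ (-(Complex.I * t.2)) *
          Complex.Gamma (a₁ + Complex.I * t.1) * Complex.Gamma (a₂ + Complex.I * t.2) *
          cBeta ((((d - m'.natAbs : ℕ) : ℂ) + (1 + Complex.I * t.1) + 2 * r) / 2)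
            (((ℓ : ℂ) + (1 + Complex.I * t.2) - 2 * r) / 2)) =
        (2 * ((Y₁ : ℂ) ^ a₁ * (Y₂ : ℂ) ^ a₂)) * ∫ x in Set.Ioi 0, whittakerKernel d r y₁ y₂ m' x := by
      simp_rw [(hMB _).2, ← integral_const_mul]
      rw [← integral_finsetSum _ fun ℓ _ ↦ (hMB ℓ).1.const_mul _]
      exact setIntegral_congr_fun measurableSet_Ioi hsum
    have hWs : Wstar d r y₁ y₂ m' = ((2 : ℂ) ^ (d + 1) * (π : ℂ))⁻¹ *
        (√((2 * d).choose (d + m'.natAbs)) : ℂ) *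
        ((2 * ((Y₁ : ℂ) ^ a₁ * (Y₂ : ℂ) ^ a₂)) *
          ∫ x in Set.Ioi 0, whittakerKernel d r y₁ y₂ m' x) := by
      rw [← hW, Wstar]
      congr 1
      refine Finset.sum_congr rfl fun ℓ _ ↦ ?_
      rw [mul_assoc]
      congr 2
      refine integral_congr_ae (.of_forall fun t ↦ ?_)
      simp only
      rw [Nat.cast_sub hm, ha₁, ha₂, hY₁_def, hY₂_def]
      ring_nf
    rw [hWs, pow_succ]
    field_simp

theorem sum_Icc_choose_mul_zpow (d : ℕ) {z : ℝ} (hz : z ≠ 0) :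
    ∑ m ∈ Finset.Icc (-(d : ℤ)) d, ((2 * d).choose (d + m.natAbs) : ℝ) * z ^ m =
      (z + z⁻¹ + 2) ^ d := by
  have h : z + z⁻¹ + 2 = (z + 1) ^ 2 / z := by
    field_simp
    ring
  rw [h, div_pow, ← pow_mul, add_pow, Finset.sum_div]
  refine Finset.sum_nbij' (fun m ↦ (m + d).toNat) (fun k ↦ (k : ℤ) - d) ?_ ?_ ?_ ?_ ?_
  · intro m hm
    simp only [Finset.mem_Icc, Finset.mem_range] at *
    omega
  · intro m hm
    simp only [Finset.mem_Icc, Finset.mem_range] at *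
    omega
  · intro m hm
    simp only [Finset.mem_Icc] at *
    omega
  · intro m hm
    omega
  · intro m hm
    simp only [Finset.mem_Icc] at hm
    have hpow : z ^ m = z ^ (m + d).toNat / z ^ d := by
      rw [eq_div_iff (pow_ne_zero d hz), ← zpow_natCast, ← zpow_natCast, ← zpow_add₀ hz]
      congr 1
      omega
    have hchoose : (2 * d).choose (d + m.natAbs) = (2 * d).choose (m + d).toNat := by
      rcases le_total 0 m with h0 | h0
      · congr 1
        omega
      · rw [← Nat.choose_symm (by omega)]
        congr 1
        omega
    rw [hpow, hchoose]
    simp only [one_pow, mul_one]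
    ring

theorem hyp_add_self_pos (x : ℝ) : 0 < hyp x + x := by
  have h : x ^ 2 < hyp x ^ 2 := by rw [hyp_sq]; linarith
  linarith [(abs_lt.1 (abs_lt_of_sq_lt_sq h (hyp_pos x).le)).1]

theorem hyp_add_self_inv (x : ℝ) : (hyp x + x)⁻¹ = hyp x - x := by
  refine inv_eq_of_mul_eq_one_right ?_
  linear_combination hyp_sq x

theorem sum_Icc_choose_mul_hyp (d : ℕ) (x x' : ℝ) :
    ∑ m ∈ Finset.Icc (-(d : ℤ)) d, ((2 * d).choose (d + m.natAbs) : ℝ) *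
      ((hyp x + x) ^ m * (hyp x' + x') ^ m) = (2 * (1 + hyp x * hyp x' + x * x')) ^ d := by
  have h := sum_Icc_choose_mul_zpow d (mul_pos (hyp_add_self_pos x) (hyp_add_self_pos x')).ne'
  simp_rw [mul_zpow] at h
  rw [h, mul_inv, hyp_add_self_inv, hyp_add_self_inv]
  ring

/-- The integrand of the fourfold integral obtained by unfolding `Psi d r (-r) 1`. -/
noncomputable def rankinKernel (d : ℕ) (r : ℂ) (y p : ℝ × ℝ) : ℂ :=
  ((((2 : ℝ) ^ d * π)⁻¹ ^ 2 * (2 * π) ^ (2 * d + 2) *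
    ((2 * (1 + hyp p.1 * hyp p.2 + p.1 * p.2)) ^ d * (hyp p.1 * hyp p.2)⁻¹) : ℝ) : ℂ) *
    ((p.1 : ℂ) ^ (-(((d : ℂ) + 1) / 2 + 3 * r)) * (p.2 : ℂ) ^ (-(((d : ℂ) + 1) / 2 - 3 * r))) *
    (((y.1 ^ d * Real.exp (-(2 * π * (hyp p.1 + hyp p.2) * y.1)) : ℝ) : ℂ) *
      ((y.2 ^ (d - 1) * Real.exp (-(2 * π * (hyp p.1 / p.1 + hyp p.2 / p.2) * y.2)) : ℝ) : ℂ))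

theorem sum_Wstar_mul_Wstar_neg {d : ℕ} (hd : 1 ≤ d) {r : ℂ} (hr : r.re = 0) {y₁ y₂ : ℝ}
    (hy₁ : 0 < y₁) (hy₂ : 0 < y₂) :
    (∑ m ∈ Finset.Icc (-(d : ℤ)) (d : ℤ), Wstar d r y₁ y₂ m * Wstar d (-r) y₁ y₂ m) *
      ((y₁ ^ 2 * y₂ : ℝ) : ℂ) ^ (1 : ℂ) / ((y₁ * y₂ : ℝ) : ℂ) ^ 3 =
    ∫ p, rankinKernel d r (y₁, y₂) p
      ∂((volume.restrict (Set.Ioi (0 : ℝ))).prod (volume.restrict (Set.Ioi (0 : ℝ)))) := by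
  have hr' : (-r).re = 0 := by simp [hr]
  have hY₁ : ((2 * π * y₁ : ℝ) : ℂ) ≠ 0 := Complex.ofReal_ne_zero.2 (by positivity)
  have hY₂ : ((2 * π * y₂ : ℝ) : ℂ) ≠ 0 := Complex.ofReal_ne_zero.2 (by positivity)
  have hm : ∀ m ∈ Finset.Icc (-(d : ℤ)) d, m.natAbs ≤ d := fun m hm ↦ by
    rw [Finset.mem_Icc] at hm
    omega
  set M := (volume.restrict (Set.Ioi (0 : ℝ))).prod (volume.restrict (Set.Ioi (0 : ℝ))) with hM
  set A : ℂ := ((2 : ℂ) ^ d * π)⁻¹ ^ 2 *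
    (((2 * π * y₁ : ℝ) : ℂ) ^ (d + 1) * ((2 * π * y₂ : ℝ) : ℂ) ^ (d + 1)) with hA
  set B : ℂ := (y₁ ^ 2 * y₂ : ℝ) / ((y₁ * y₂ : ℝ) : ℂ) ^ 3 with hB
  have hprod : ∀ m ∈ Finset.Icc (-(d : ℤ)) d, Wstar d r y₁ y₂ m * Wstar d (-r) y₁ y₂ m =
      ∫ p, A * ((2 * d).choose (d + m.natAbs) : ℂ) *
        (whittakerKernel d r y₁ y₂ m p.1 * whittakerKernel d (-r) y₁ y₂ m p.2) ∂M := by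
    intro m hmem
    rw [integral_const_mul, hM, integral_prod_mul,
      (Wstar_eq_integral_whittakerKernel hd hr hy₁ hy₂ (hm m hmem)).2,
      (Wstar_eq_integral_whittakerKernel hd hr' hy₁ hy₂ (hm m hmem)).2]
    have hs : ((√((2 * d).choose (d + m.natAbs)) : ℝ) : ℂ) * (√((2 * d).choose (d + m.natAbs)) : ℝ) =
        ((2 * d).choose (d + m.natAbs) : ℂ) := by
      rw [← Complex.ofReal_mul, Real.mul_self_sqrt (by positivity), Complex.ofReal_natCast]
    have h₁ : ((2 * π * y₁ : ℝ) : ℂ) ^ (((d : ℂ) + 1) / 2 - r) *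
        ((2 * π * y₁ : ℝ) : ℂ) ^ (((d : ℂ) + 1) / 2 - (-r)) = ((2 * π * y₁ : ℝ) : ℂ) ^ (d + 1) := by
      rw [← Complex.cpow_add _ _ hY₁, ← Complex.cpow_natCast]
      push_cast
      ring_nf
    have h₂ : ((2 * π * y₂ : ℝ) : ℂ) ^ (((d : ℂ) + 1) / 2 + r) *
        ((2 * π * y₂ : ℝ) : ℂ) ^ (((d : ℂ) + 1) / 2 + (-r)) = ((2 * π * y₂ : ℝ) : ℂ) ^ (d + 1) := by
      rw [← Complex.cpow_add _ _ hY₂, ← Complex.cpow_natCast]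
      push_cast
      ring_nf
    rw [hA, ← hs, ← h₁, ← h₂]
    ring
  have hintegrable : ∀ m ∈ Finset.Icc (-(d : ℤ)) d, Integrable (fun p : ℝ × ℝ ↦
      A * ((2 * d).choose (d + m.natAbs) : ℂ) *
        (whittakerKernel d r y₁ y₂ m p.1 * whittakerKernel d (-r) y₁ y₂ m p.2)) M := fun m hmem ↦
    ((Wstar_eq_integral_whittakerKernel hd hr hy₁ hy₂ (hm m hmem)).1.mul_prod
      (Wstar_eq_integral_whittakerKernel hd hr' hy₁ hy₂ (hm m hmem)).1).const_mul _
  rw [Complex.cpow_one, mul_div_assoc, ← hB, Finset.sum_congr rfl hprod,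
    ← integral_finsetSum _ hintegrable, ← integral_mul_const]
  refine integral_congr_ae (.of_forall fun p ↦ ?_)
  have hsum := congrArg Complex.ofReal (sum_Icc_choose_mul_hyp d p.1 p.2)
  have hAB : A * B = ((((2 : ℝ) ^ d * π)⁻¹ ^ 2 * (2 * π) ^ (2 * d + 2) *
      (y₁ ^ d * y₂ ^ (d - 1)) : ℝ) : ℂ) := by
    obtain ⟨k, rfl⟩ : ∃ k, d = k + 1 := ⟨d - 1, by omega⟩
    have hy₁ : (y₁ : ℂ) ≠ 0 := Complex.ofReal_ne_zero.2 hy₁.ne'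
    have hy₂ : (y₂ : ℂ) ≠ 0 := Complex.ofReal_ne_zero.2 hy₂.ne'
    rw [hA, hB]
    push_cast
    field_simp
    ring
  have hexp₁ : Real.exp (-(2 * π * (hyp p.1 + hyp p.2) * y₁)) =
      Real.exp (-(2 * π * y₁ * hyp p.1)) * Real.exp (-(2 * π * y₁ * hyp p.2)) := by
    rw [← Real.exp_add]
    ring_nf
  have hexp₂ : Real.exp (-(2 * π * (hyp p.1 / p.1 + hyp p.2 / p.2) * y₂)) =
      Real.exp (-(2 * π * y₂ * hyp p.1 / p.1)) * Real.exp (-(2 * π * y₂ * hyp p.2 / p.2)) := by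
    rw [← Real.exp_add]
    ring_nf
  have hterm : ∀ m : ℤ, A * ((2 * d).choose (d + m.natAbs) : ℂ) *
      (whittakerKernel d r y₁ y₂ m p.1 * whittakerKernel d (-r) y₁ y₂ m p.2) =
      ((((2 * d).choose (d + m.natAbs) : ℝ) *
        ((hyp p.1 + p.1) ^ m * (hyp p.2 + p.2) ^ m) : ℝ) : ℂ) * (A * (((hyp p.1 * hyp p.2)⁻¹ : ℝ) *
      ((p.1 : ℂ) ^ (-(((d : ℂ) + 1) / 2 + 3 * r)) * (p.2 : ℂ) ^ (-(((d : ℂ) + 1) / 2 - 3 * r))) *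
      ((Real.exp (-(2 * π * (hyp p.1 + hyp p.2) * y₁)) *
        Real.exp (-(2 * π * (hyp p.1 / p.1 + hyp p.2 / p.2) * y₂)) : ℝ) : ℂ))) := by
    intro m
    have h3 : (3 : ℂ) * -r = -(3 * r) := by ring
    rw [whittakerKernel, whittakerKernel, hexp₁, hexp₂, h3, ← sub_eq_add_neg]
    push_cast
    ring
  simp_rw [hterm]
  rw [← Finset.sum_mul, ← Complex.ofReal_sum, hsum, rankinKernel]
  simp only
  rw [show ∀ a b : ℂ, a * (A * b) * B = (A * B) * (a * b) from fun a b ↦ by ring, hAB]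
  simp only [Complex.ofReal_mul]
  ring

theorem ae_prod_Ioi_pos : ∀ᵐ y : ℝ × ℝ ∂((volume.restrict (Set.Ioi (0 : ℝ))).prod
    (volume.restrict (Set.Ioi (0 : ℝ)))), 0 < y.1 ∧ 0 < y.2 := by
  have hμ := (ae_restrict_iff' (μ := volume) measurableSet_Ioi).2
    (.of_forall fun (x : ℝ) (hx : x ∈ Set.Ioi (0 : ℝ)) ↦ hx)
  exact (Measure.quasiMeasurePreserving_fst.ae hμ).and (Measure.quasiMeasurePreserving_snd.ae hμ)

theorem integral_pow_mul_exp_neg (n : ℕ) {b : ℝ} (hb : 0 < b) :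
    ∫ y in Set.Ioi 0, y ^ n * Real.exp (-(b * y)) = n.factorial * (b ^ (n + 1))⁻¹ := by
  have h := Real.integral_rpow_mul_exp_neg_mul_Ioi (a := n + 1) (by positivity) hb
  rw [Real.Gamma_nat_eq_factorial] at h
  simp only [add_sub_cancel_right, Real.rpow_natCast] at h
  rw [h, ← Nat.cast_succ, Real.rpow_natCast, one_div, inv_pow, mul_comm]

theorem integrableOn_pow_mul_exp_neg (n : ℕ) {b : ℝ} (hb : 0 < b) :
    IntegrableOn (fun y ↦ y ^ n * Real.exp (-(b * y))) (Set.Ioi 0) := by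
  refine not_imp_comm.1 integral_undef ?_
  rw [integral_pow_mul_exp_neg n hb]
  positivity

/-- The integral of `rankinKernel` over its first variable. -/
noncomputable def rankinInner (d : ℕ) (r : ℂ) (p : ℝ × ℝ) : ℂ :=
  ((2 / (2 ^ d * π) * (d.factorial * (d - 1).factorial) * ((p.1 + p.2) ^ d)⁻¹ *
    (hyp p.1 * hyp p.2 * (hyp p.1 + hyp p.2))⁻¹ : ℝ) : ℂ) *
    ((p.1 : ℂ) ^ (((d : ℂ) - 1) / 2 - 3 * r) * (p.2 : ℂ) ^ (((d : ℂ) - 1) / 2 + 3 * r))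

theorem rankinKernel_left {d : ℕ} (hd : 1 ≤ d) (r : ℂ) {x x' : ℝ} (hx : 0 < x) (hx' : 0 < x') :
    Integrable (fun y ↦ rankinKernel d r y (x, x'))
      ((volume.restrict (Set.Ioi (0 : ℝ))).prod (volume.restrict (Set.Ioi (0 : ℝ)))) ∧
    ∫ y, rankinKernel d r y (x, x')
      ∂((volume.restrict (Set.Ioi (0 : ℝ))).prod (volume.restrict (Set.Ioi (0 : ℝ)))) =
        rankinInner d r (x, x') ∧
    ∫ y, ‖rankinKernel d r y (x, x')‖
      ∂((volume.restrict (Set.Ioi (0 : ℝ))).prod (volume.restrict (Set.Ioi (0 : ℝ)))) =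
        ‖rankinInner d r (x, x')‖ := by
  have h0 := hyp_pos x
  have h0' := hyp_pos x'
  have hb₁ : 0 < 2 * π * (hyp x + hyp x') := by positivity
  have hb₂ : 0 < 2 * π * (hyp x / x + hyp x' / x') := by positivity
  have hxc : (x : ℂ) ≠ 0 := Complex.ofReal_ne_zero.2 hx.ne'
  have hxc' : (x' : ℂ) ≠ 0 := Complex.ofReal_ne_zero.2 hx'.ne'
  have hval : ∫ y, rankinKernel d r y (x, x')
      ∂((volume.restrict (Set.Ioi (0 : ℝ))).prod (volume.restrict (Set.Ioi (0 : ℝ)))) =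
        rankinInner d r (x, x') := by
    simp only [rankinKernel]
    rw [integral_const_mul, integral_prod_mul
      (fun y : ℝ ↦ ((y ^ d * Real.exp (-(2 * π * (hyp x + hyp x') * y)) : ℝ) : ℂ))
      (fun y : ℝ ↦ ((y ^ (d - 1) * Real.exp (-(2 * π * (hyp x / x + hyp x' / x') * y)) : ℝ) : ℂ)),
      integral_complex_ofReal, integral_complex_ofReal, integral_pow_mul_exp_neg _ hb₁,
      integral_pow_mul_exp_neg _ hb₂, Nat.sub_add_cancel hd, rankinInner]
    have e₁ : (x : ℂ) ^ (((d : ℂ) - 1) / 2 - 3 * r) =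
        (x : ℂ) ^ d * (x : ℂ) ^ (-(((d : ℂ) + 1) / 2 + 3 * r)) := by
      rw [← Complex.cpow_natCast, ← Complex.cpow_add _ _ hxc]
      ring_nf
    have e₂ : (x' : ℂ) ^ (((d : ℂ) - 1) / 2 + 3 * r) =
        (x' : ℂ) ^ d * (x' : ℂ) ^ (-(((d : ℂ) + 1) / 2 - 3 * r)) := by
      rw [← Complex.cpow_natCast, ← Complex.cpow_add _ _ hxc']
      ring_nf
    have hreal : ((2 : ℝ) ^ d * π)⁻¹ ^ 2 * (2 * π) ^ (2 * d + 2) *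
        ((2 * (1 + hyp x * hyp x' + x * x')) ^ d * (hyp x * hyp x')⁻¹) *
        ((d.factorial * ((2 * π * (hyp x + hyp x')) ^ (d + 1))⁻¹) *
          ((d - 1).factorial * ((2 * π * (hyp x / x + hyp x' / x')) ^ d)⁻¹)) =
        2 / (2 ^ d * π) * (d.factorial * (d - 1).factorial) * ((x + x') ^ d)⁻¹ *
          (hyp x * hyp x' * (hyp x + hyp x'))⁻¹ * (x ^ d * x' ^ d) := by
      have key : 1 + hyp x * hyp x' + x * x' =
          (hyp x + hyp x') * (hyp x / x + hyp x' / x') * (x * x') / (x + x') := by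
        field_simp
        linear_combination -x' * hyp_sq x - x * hyp_sq x'
      have hS : 0 < hyp x / x + hyp x' / x' := by positivity
      rw [key]
      generalize hyp x / x + hyp x' / x' = S at *
      simp only [div_pow, mul_pow, pow_add, pow_mul, pow_one]
      rw [pow_right_comm (2 : ℝ) 2 d, pow_right_comm π 2 d]
      field_simp
    rw [e₁, e₂]
    have hrealc := congrArg Complex.ofReal hreal
    simp only [Complex.ofReal_mul, Complex.ofReal_pow x, Complex.ofReal_pow x'] at hrealc ⊢
    linear_combination ((x : ℂ) ^ (-(((d : ℂ) + 1) / 2 + 3 * r)) *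
      (x' : ℂ) ^ (-(((d : ℂ) + 1) / 2 - 3 * r))) * hrealc
  refine ⟨?_, hval, ?_⟩
  · exact ((integrableOn_pow_mul_exp_neg d hb₁).ofReal.mul_prod
      (integrableOn_pow_mul_exp_neg (d - 1) hb₂).ofReal).const_mul _
  · have hnorm : ∀ᵐ y : ℝ × ℝ ∂((volume.restrict (Set.Ioi (0 : ℝ))).prod
        (volume.restrict (Set.Ioi (0 : ℝ)))), ‖rankinKernel d r y (x, x')‖ =
        ‖((((2 : ℝ) ^ d * π)⁻¹ ^ 2 * (2 * π) ^ (2 * d + 2) *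
          ((2 * (1 + hyp x * hyp x' + x * x')) ^ d * (hyp x * hyp x')⁻¹) : ℝ) : ℂ) *
          ((x : ℂ) ^ (-(((d : ℂ) + 1) / 2 + 3 * r)) * (x' : ℂ) ^ (-(((d : ℂ) + 1) / 2 - 3 * r)))‖ *
        ((y.1 ^ d * Real.exp (-(2 * π * (hyp x + hyp x') * y.1))) *
          (y.2 ^ (d - 1) * Real.exp (-(2 * π * (hyp x / x + hyp x' / x') * y.2)))) := by
      filter_upwards [ae_prod_Ioi_pos] with y hy
      have hy₁ := hy.1
      have hy₂ := hy.2
      rw [rankinKernel, norm_mul, norm_mul (Complex.ofReal (_ ^ d * _)), Complex.norm_real (_ ^ d * _),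
        Complex.norm_real (_ ^ (d - 1) * _), Real.norm_of_nonneg (by positivity),
        Real.norm_of_nonneg (by positivity)]
    rw [integral_congr_ae hnorm, ← hval, integral_const_mul, integral_prod_mul
      (fun y : ℝ ↦ y ^ d * Real.exp (-(2 * π * (hyp x + hyp x') * y)))
      (fun y : ℝ ↦ y ^ (d - 1) * Real.exp (-(2 * π * (hyp x / x + hyp x' / x') * y)))]
    simp only [rankinKernel]
    rw [integral_const_mul, integral_prod_mul
      (fun y : ℝ ↦ ((y ^ d * Real.exp (-(2 * π * (hyp x + hyp x') * y)) : ℝ) : ℂ))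
      (fun y : ℝ ↦ ((y ^ (d - 1) * Real.exp (-(2 * π * (hyp x / x + hyp x' / x') * y)) : ℝ) : ℂ)),
      integral_complex_ofReal, integral_complex_ofReal, integral_pow_mul_exp_neg _ hb₁,
      integral_pow_mul_exp_neg _ hb₂, ← Complex.ofReal_mul (_ * _) (_ * _)]
    conv_rhs => rw [norm_mul, Complex.norm_real, Real.norm_of_nonneg (by positivity)]

theorem hasDerivAt_hyp (x : ℝ) : HasDerivAt hyp (x / hyp x) x := by
  have h := ((hasDerivAt_pow 2 x).const_add 1).sqrt (by positivity)
  refine h.congr_deriv ?_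
  rw [hyp]
  field_simp
  norm_num

theorem tendsto_div_hyp_add_hyp {u : ℝ} (hu : 0 < u) :
    Filter.Tendsto (fun x ↦ x / (hyp x + hyp (u * x))) Filter.atTop (nhds (1 + u)⁻¹) := by
  have h1 : Filter.Tendsto (fun x : ℝ ↦ (x ^ 2)⁻¹) Filter.atTop (nhds 0) :=
    tendsto_inv_atTop_zero.comp (Filter.tendsto_pow_atTop two_ne_zero)
  have h2 : Filter.Tendsto (fun x : ℝ ↦ (√((x ^ 2)⁻¹ + 1) + √((x ^ 2)⁻¹ + u ^ 2))⁻¹)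
      Filter.atTop (nhds (√(0 + 1) + √(0 + u ^ 2))⁻¹) :=
    (((h1.add_const 1).sqrt).add ((h1.add_const (u ^ 2)).sqrt)).inv₀ (by positivity)
  simp only [zero_add, Real.sqrt_one, Real.sqrt_sq hu.le] at h2
  refine h2.congr' ?_
  filter_upwards [Filter.eventually_gt_atTop 0] with x hx
  have e : ∀ v : ℝ, √((x ^ 2)⁻¹ + v ^ 2) = hyp (v * x) / x := fun v ↦ by
    rw [hyp, eq_div_iff hx.ne', ← Real.sqrt_sq hx.le, ← Real.sqrt_mul (by positivity),
      Real.sqrt_sq hx.le]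
    congr 1
    field_simp
  have e1 := e 1
  rw [one_pow, one_mul] at e1
  rw [e1, e u]
  field_simp

theorem integral_inv_hyp_mul_hyp {u : ℝ} (hu : 0 < u) :
    IntegrableOn (fun x ↦ (hyp x * hyp (u * x) * (hyp x + hyp (u * x)))⁻¹) (Set.Ioi 0) ∧
    ∫ x in Set.Ioi 0, (hyp x * hyp (u * x) * (hyp x + hyp (u * x)))⁻¹ = (1 + u)⁻¹ := by
  have hderiv : ∀ x ∈ Set.Ici (0 : ℝ), HasDerivAt (fun x ↦ x / (hyp x + hyp (u * x)))
      ((hyp x * hyp (u * x) * (hyp x + hyp (u * x)))⁻¹) x := by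
    intro x _
    have h0 := hyp_pos x
    have h0' := hyp_pos (u * x)
    have h := (hasDerivAt_id x).div ((hasDerivAt_hyp x).add
      ((hasDerivAt_hyp (u * x)).comp x ((hasDerivAt_id x).const_mul u))) (by simp; positivity)
    refine h.congr_deriv ?_
    simp only [id, Pi.add_apply, Function.comp_apply]
    field_simp
    linear_combination hyp (u * x) * hyp_sq x + hyp x * hyp_sq (u * x)
  have hpos : ∀ x ∈ Set.Ioi (0 : ℝ), 0 ≤ (hyp x * hyp (u * x) * (hyp x + hyp (u * x)))⁻¹ := by
    intro x _
    have h0 := hyp_pos x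
    have h0' := hyp_pos (u * x)
    positivity
  exact ⟨integrableOn_Ioi_deriv_of_nonneg' hderiv hpos (tendsto_div_hyp_add_hyp hu), by
    simpa using integral_Ioi_of_hasDerivAt_of_nonneg' hderiv hpos (tendsto_div_hyp_add_hyp hu)⟩

theorem integral_Ioi_cpow_mul_inv_pow {d : ℕ} {r : ℂ} (hr : r.re = 0) :
    IntegrableOn (fun u : ℝ ↦ (u : ℂ) ^ (((d : ℂ) - 1) / 2 + 3 * r) *
      ((((1 + u) ^ (d + 1))⁻¹ : ℝ) : ℂ)) (Set.Ioi 0) ∧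
    ∫ u in Set.Ioi (0 : ℝ), (u : ℂ) ^ (((d : ℂ) - 1) / 2 + 3 * r) *
      ((((1 + u) ^ (d + 1))⁻¹ : ℝ) : ℂ) =
    Complex.Gamma (((d : ℂ) + 1) / 2 + 3 * r) * Complex.Gamma (((d : ℂ) + 1) / 2 - 3 * r) /
      d.factorial := by
  have h₁ : 0 < (((d : ℂ) + 1) / 2 + 3 * r).re := by simp [hr]; positivity
  have h₂ : 0 < (((d : ℂ) + 1) / 2 - 3 * r).re := by simp [hr]; positivity
  have hval : ∫ u in Set.Ioi (0 : ℝ), (u : ℂ) ^ (((d : ℂ) - 1) / 2 + 3 * r) *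
      ((((1 + u) ^ (d + 1))⁻¹ : ℝ) : ℂ) =
      Complex.Gamma (((d : ℂ) + 1) / 2 + 3 * r) * Complex.Gamma (((d : ℂ) + 1) / 2 - 3 * r) /
        d.factorial := by
    have hsum : ((d : ℂ) + 1) / 2 - 3 * r + (((d : ℂ) + 1) / 2 + 3 * r) = d + 1 := by ring
    have h := integral_Ioi_beta h₂ h₁
    rw [cBeta, hsum, Complex.Gamma_nat_eq_factorial] at h
    rw [mul_comm (Complex.Gamma _), ← h]
    refine setIntegral_congr_fun measurableSet_Ioi fun u _ ↦ ?_
    rw [show ((d : ℂ) - 1) / 2 + 3 * r = ((d : ℂ) + 1) / 2 + 3 * r - 1 by ring, Complex.cpow_neg,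
      ← Nat.cast_succ, Complex.cpow_natCast, Complex.ofReal_inv, Complex.ofReal_pow]
  refine ⟨not_imp_comm.1 integral_undef ?_, hval⟩
  rw [hval]
  exact div_ne_zero (mul_ne_zero (Complex.Gamma_ne_zero_of_re_pos h₁)
    (Complex.Gamma_ne_zero_of_re_pos h₂)) (Nat.cast_ne_zero.2 d.factorial_ne_zero)

theorem mul_rankinInner_mul (d : ℕ) (r : ℂ) {x u : ℝ} (hx : 0 < x) (hu : 0 < u) :
    (x : ℂ) * rankinInner d r (x, x * u) =
      ((2 / (2 ^ d * π) * (d.factorial * (d - 1).factorial) : ℝ) : ℂ) *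
        ((u : ℂ) ^ (((d : ℂ) - 1) / 2 + 3 * r) * ((((1 + u) ^ d)⁻¹ : ℝ) : ℂ)) *
        (((hyp x * hyp (u * x) * (hyp x + hyp (u * x)))⁻¹ : ℝ) : ℂ) := by
  have hxc : (x : ℂ) ≠ 0 := Complex.ofReal_ne_zero.2 hx.ne'
  have huc : ((1 + u : ℝ) : ℂ) ≠ 0 := Complex.ofReal_ne_zero.2 (by positivity)
  have hpow : (x : ℂ) * ((x : ℂ) ^ (((d : ℂ) - 1) / 2 - 3 * r) *
      ((x : ℂ) ^ (((d : ℂ) - 1) / 2 + 3 * r))) = (x : ℂ) ^ d := by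
    rw [← Complex.cpow_add _ _ hxc, ← Complex.cpow_natCast]
    nth_rw 1 [← Complex.cpow_one (x : ℂ)]
    rw [← Complex.cpow_add _ _ hxc]
    ring_nf
  have hinv : (((x + x * u) ^ d)⁻¹ : ℝ) = (x ^ d)⁻¹ * ((1 + u) ^ d)⁻¹ := by
    rw [← mul_inv, ← mul_pow, mul_add, mul_one]
  simp only [rankinInner]
  rw [hinv, Complex.ofReal_mul x u, Complex.mul_cpow_ofReal_nonneg hx.le hu.le, mul_comm u x]
  have hc : (x : ℂ) ^ d * ((x : ℂ) ^ d)⁻¹ = 1 := mul_inv_cancel₀ (pow_ne_zero d hxc)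
  simp only [Complex.ofReal_mul, Complex.ofReal_inv (x ^ d), Complex.ofReal_pow x]
  generalize (2 / (2 ^ d * π) : ℝ) = K
  generalize (((((1 + u) ^ d)⁻¹ : ℝ)) : ℂ) = L
  generalize ((((hyp x * hyp (x * u) * (hyp x + hyp (x * u)))⁻¹ : ℝ)) : ℂ) = G
  generalize (x : ℂ) ^ (((d : ℂ) - 1) / 2 - 3 * r) = X₁ at *
  generalize (x : ℂ) ^ (((d : ℂ) - 1) / 2 + 3 * r) = X₂ at *
  generalize (u : ℂ) ^ (((d : ℂ) - 1) / 2 + 3 * r) = U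
  generalize ((x : ℂ) ^ d)⁻¹ = X' at *
  rw [← hpow] at hc
  linear_combination (K : ℂ) * ((d.factorial : ℝ) : ℂ) * (((d - 1).factorial : ℝ) : ℂ) * L * G * U * hc

theorem integral_rankinInner (d : ℕ) {r : ℂ} (hr : r.re = 0) :
    Integrable (rankinInner d r)
      ((volume.restrict (Set.Ioi (0 : ℝ))).prod (volume.restrict (Set.Ioi (0 : ℝ)))) ∧
    ∫ p, rankinInner d r p
      ∂((volume.restrict (Set.Ioi (0 : ℝ))).prod (volume.restrict (Set.Ioi (0 : ℝ)))) =
      (2 / (2 ^ d * π) * (d - 1).factorial : ℂ) *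
        (Complex.Gamma (((d : ℂ) + 1) / 2 + 3 * r) * Complex.Gamma (((d : ℂ) + 1) / 2 - 3 * r)) := by
  set μ := (volume : Measure ℝ).restrict (Set.Ioi 0) with hμ
  have hpos : ∀ᵐ x ∂μ, 0 < x := (ae_restrict_iff' measurableSet_Ioi).2 (.of_forall fun x hx ↦ hx)
  set c : ℝ → ℂ := fun u ↦ ((2 / (2 ^ d * π) * (d.factorial * (d - 1).factorial) : ℝ) : ℂ) *
    ((u : ℂ) ^ (((d : ℂ) - 1) / 2 + 3 * r) * ((((1 + u) ^ d)⁻¹ : ℝ) : ℂ)) with hc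
  set G : ℝ → ℝ → ℝ := fun x u ↦ (hyp x * hyp (u * x) * (hyp x + hyp (u * x)))⁻¹ with hG
  have hG0 : ∀ x u, 0 ≤ G x u := fun x u ↦ by
    have h0 := hyp_pos x
    have h0' := hyp_pos (u * x)
    simp only [hG]
    positivity
  have hcG : ∀ u, 0 < u → c u * (((1 + u)⁻¹ : ℝ) : ℂ) =
      ((2 / (2 ^ d * π) * (d.factorial * (d - 1).factorial) : ℝ) : ℂ) *
        ((u : ℂ) ^ (((d : ℂ) - 1) / 2 + 3 * r) * ((((1 + u) ^ (d + 1))⁻¹ : ℝ) : ℂ)) := fun u _ ↦ by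
    rw [hc, pow_succ (1 + u) d, mul_inv, Complex.ofReal_mul (_⁻¹) (_⁻¹)]
    ring
  have hcG_int : Integrable (fun u ↦ c u * (((1 + u)⁻¹ : ℝ) : ℂ)) μ :=
    IntegrableOn.congr_fun ((integral_Ioi_cpow_mul_inv_pow hr).1.const_mul _)
      (fun u hu ↦ (hcG u hu).symm) measurableSet_Ioi
  have hT : Integrable (fun q : ℝ × ℝ ↦ c q.2 * (G q.1 q.2 : ℂ)) (μ.prod μ) := by
    refine (integrable_prod_iff' (Measurable.aestronglyMeasurable (by fun_prop))).2 ⟨?_, ?_⟩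
    · filter_upwards [hpos] with u hu
      exact (integral_inv_hyp_mul_hyp hu).1.ofReal.const_mul _
    · refine hcG_int.norm.congr ?_
      filter_upwards [hpos] with u hu
      simp only [norm_mul, Complex.norm_real]
      rw [integral_const_mul, Real.norm_of_nonneg (by positivity)]
      simp_rw [fun x ↦ Real.norm_of_nonneg (hG0 x u)]
      rw [(integral_inv_hyp_mul_hyp hu).2]
  have hQT : ∀ x : ℝ, 0 < x → ∀ u ∈ Set.Ioi (0 : ℝ),
      (x : ℂ) * rankinInner d r (x, x * u) = c u * (G x u : ℂ) := fun x hx u hu ↦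
    mul_rankinInner_mul d r hx hu
  have hsub : ∀ x : ℝ, 0 < x → Integrable (fun u ↦ c u * (G x u : ℂ)) μ →
      Integrable (fun x' ↦ rankinInner d r (x, x')) μ := fun x hx h ↦ by
    have hxc : (x : ℂ) ≠ 0 := Complex.ofReal_ne_zero.2 hx.ne'
    have h' : IntegrableOn (fun u ↦ rankinInner d r (x, x * u)) (Set.Ioi 0) :=
      IntegrableOn.congr_fun (h.const_mul (x : ℂ)⁻¹) (fun u hu ↦ by
        rw [← hQT x hx u hu, inv_mul_cancel_left₀ hxc]) measurableSet_Ioi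
    have := (integrableOn_Ioi_comp_mul_left_iff (fun x' ↦ rankinInner d r (x, x')) 0 hx).1 h'
    rwa [mul_zero] at this
  have hQ_meas : Measurable (rankinInner d r) := by
    unfold rankinInner
    fun_prop
  have hQ : Integrable (rankinInner d r) (μ.prod μ) := by
    refine (integrable_prod_iff hQ_meas.aestronglyMeasurable).2 ⟨?_, ?_⟩
    · filter_upwards [hpos, hT.prod_right_ae] with x hx h
      exact hsub x hx h
    · refine hT.norm.integral_prod_left.congr ?_
      filter_upwards [hpos] with x hx
      have h := integral_comp_mul_left_Ioi (fun x' ↦ ‖rankinInner d r (x, x')‖) 0 hx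
      rw [mul_zero, eq_inv_smul_iff₀ hx.ne', smul_eq_mul, ← integral_const_mul] at h
      rw [← h]
      refine setIntegral_congr_fun measurableSet_Ioi fun u hu ↦ ?_
      rw [← hQT x hx u hu, norm_mul, Complex.norm_real, Real.norm_of_nonneg hx.le]
  refine ⟨hQ, ?_⟩
  have hswap : ∫ p, rankinInner d r p ∂(μ.prod μ) = ∫ x, ∫ u, c u * (G x u : ℂ) ∂μ ∂μ := by
    rw [integral_prod _ hQ]
    refine integral_congr_ae ?_
    filter_upwards [hpos] with x hx
    have h := integral_comp_mul_left_Ioi (fun x' ↦ rankinInner d r (x, x')) 0 hx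
    rw [mul_zero, eq_inv_smul_iff₀ hx.ne', Complex.real_smul, ← integral_const_mul] at h
    rw [← h]
    exact setIntegral_congr_fun measurableSet_Ioi (hQT x hx)
  rw [hswap, integral_integral_swap hT]
  have hin : ∀ u ∈ Set.Ioi (0 : ℝ), ∫ x, c u * (G x u : ℂ) ∂μ = _ := fun u hu ↦ by
    rw [integral_const_mul, integral_complex_ofReal, (integral_inv_hyp_mul_hyp hu).2, hcG u hu]
  rw [setIntegral_congr_fun measurableSet_Ioi hin, integral_const_mul,
    (integral_Ioi_cpow_mul_inv_pow hr).2]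
  have hfac : (d.factorial : ℂ) ≠ 0 := Nat.cast_ne_zero.2 d.factorial_ne_zero
  push_cast
  field_simp

theorem integrable_rankinKernel {d : ℕ} (hd : 1 ≤ d) {r : ℂ} (hr : r.re = 0) :
    Integrable (fun q : (ℝ × ℝ) × (ℝ × ℝ) ↦ rankinKernel d r q.1 q.2)
      (((volume.restrict (Set.Ioi (0 : ℝ))).prod (volume.restrict (Set.Ioi (0 : ℝ)))).prod
        ((volume.restrict (Set.Ioi (0 : ℝ))).prod (volume.restrict (Set.Ioi (0 : ℝ))))) := by
  refine (integrable_prod_iff' (Measurable.aestronglyMeasurable ?_)).2 ⟨?_, ?_⟩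
  · unfold rankinKernel
    fun_prop
  · filter_upwards [ae_prod_Ioi_pos] with p hp
    exact (rankinKernel_left hd r hp.1 hp.2).1
  · refine (integral_rankinInner d hr).1.norm.congr ?_
    filter_upwards [ae_prod_Ioi_pos] with p hp
    exact (rankinKernel_left hd r hp.1 hp.2).2.2.symm

/-- Evaluation of `Ψ^d(r, -r, 1)`. -/
theorem Psi_at_one (d : ℕ) (hd : 2 ≤ d) (r : ℂ) (hr : r.re = 0) :
    Psi d r (-r) 1 =
      (2 : ℂ) ^ (1 - (d : ℂ)) * (Real.pi : ℂ)⁻¹ * Complex.Gamma (d : ℂ) *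
        Complex.Gamma (((d : ℂ) + 1) / 2 + 3 * r) *
          Complex.Gamma (((d : ℂ) + 1) / 2 - 3 * r) := by
  have hd1 : 1 ≤ d := by omega
  have hI := integrable_rankinKernel hd1 hr
  have hPsi : Psi d r (-r) 1 = ∫ y₁ in Set.Ioi (0 : ℝ), ∫ y₂ in Set.Ioi (0 : ℝ),
      ∫ p, rankinKernel d r (y₁, y₂) p
        ∂((volume.restrict (Set.Ioi (0 : ℝ))).prod (volume.restrict (Set.Ioi (0 : ℝ)))) :=
    setIntegral_congr_fun measurableSet_Ioi fun y₁ hy₁ ↦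
      setIntegral_congr_fun measurableSet_Ioi fun y₂ hy₂ ↦
        sum_Wstar_mul_Wstar_neg hd1 hr hy₁ hy₂
  rw [hPsi, ← integral_prod (fun y ↦ ∫ p, rankinKernel d r y p
      ∂((volume.restrict (Set.Ioi (0 : ℝ))).prod (volume.restrict (Set.Ioi (0 : ℝ)))))
    hI.integral_prod_left, integral_integral_swap hI]
  have hinner : ∀ᵐ p : ℝ × ℝ ∂((volume.restrict (Set.Ioi (0 : ℝ))).prod
      (volume.restrict (Set.Ioi (0 : ℝ)))), ∫ y, rankinKernel d r y p
      ∂((volume.restrict (Set.Ioi (0 : ℝ))).prod (volume.restrict (Set.Ioi (0 : ℝ)))) =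
        rankinInner d r p := by
    filter_upwards [ae_prod_Ioi_pos] with p hp
    exact (rankinKernel_left hd1 r hp.1 hp.2).2.1
  rw [integral_congr_ae hinner, (integral_rankinInner d hr).2]
  obtain ⟨k, rfl⟩ : ∃ k, d = k + 1 := ⟨d - 1, by omega⟩
  have hpow : (2 : ℂ) ^ (1 - ((k + 1 : ℕ) : ℂ)) = 2 / 2 ^ (k + 1) := by
    rw [Complex.cpow_sub _ _ two_ne_zero, Complex.cpow_one, Complex.cpow_natCast]
  rw [hpow, show Complex.Gamma ((k + 1 : ℕ) : ℂ) = k.factorial by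
    rw [Nat.cast_succ, Complex.Gamma_nat_eq_factorial], Nat.add_sub_cancel]
  field_simp
end

section
/- Let d ≥ 2 be an integer and let s₁, s₂, t, r, r' ∈ ℂ satisfy Re(s₁+2r) > 0, Re(s₂−2r) > 0, Re(2t−s₁+2r') > 0, and Re(t−s₂−2r') > 0. Then ∑_{m'=−d}^{d} binom(2d,d+m) ∑_{ℓ₁=0}^{m} ∑_{ℓ₂=0}^{m} ε^{ℓ₁+ℓ₂} binom(m,ℓ₁) binom(m,ℓ₂) B((d−m+s₁+2r)/2,(ℓ₁+s₂−2r)/2) B((d−m+2t−s₁+2r')/2,(ℓ₂+t−s₂−2r')/2) = 2^d ∫₀¹∫₀¹ x₁^{(s₁+2r)/2−1} (1−x₁)^{(s₂−2r)/2−1} x₂^{(2t−s₁+2r')/2−1} (1−x₂)^{(t−s₂−2r')/2−1} (1+√(x₁x₂)+√(1−x₁)·√(1−x₂))^d dx₁ dx₂, where in the sum m := |m'|, and ε := 1 if m' ≥ 0 and ε := −1 if m' < 0. -/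
open Complex Real Set MeasureTheory Finset

/-- A two-sided binomial expansion of `(P + Q) ^ (2 * d)`, indexed symmetrically around `0`. -/
lemma sum_Icc_choose_mul_pow (d : ℕ) (P Q : ℝ) :
    ∑ m' ∈ Finset.Icc (-(d : ℤ)) (d : ℤ), ((2 * d).choose (d + m'.natAbs) : ℝ) *
      ((P * Q) ^ (d - m'.natAbs) * ((if 0 ≤ m' then P else Q) ^ 2) ^ m'.natAbs) =
    ((P + Q) ^ 2) ^ d := by
  rw [← pow_mul, add_pow]
  refine Finset.sum_bij' (fun m' _ => ((d : ℤ) + m').toNat) (fun k _ => (k : ℤ) - d) ?_ ?_ ?_ ?_ ?_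
  · intro m' hm
    simp only [Finset.mem_Icc, Finset.mem_range] at *
    omega
  · intro k hk
    simp only [Finset.mem_Icc, Finset.mem_range] at *
    omega
  · intro m' hm
    simp only [Finset.mem_Icc] at *
    omega
  · intro k hk
    omega
  · intro m' hm
    simp only [Finset.mem_Icc] at hm
    split_ifs with h
    · obtain ⟨m, rfl⟩ := Int.eq_ofNat_of_zero_le h
      obtain ⟨e, rfl⟩ : ∃ e, d = m + e := ⟨d - m, by omega⟩
      have e1 : (((m + e : ℕ) : ℤ) + (m : ℤ)).toNat = m + e + m := by omega
      have e2 : 2 * (m + e) - (m + e + m) = e := by omega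
      rw [e1, e2, Int.natAbs_natCast, Nat.add_sub_cancel_left]
      ring
    · obtain ⟨m, rfl⟩ : ∃ m : ℕ, m' = -(m : ℤ) := ⟨m'.natAbs, by omega⟩
      obtain ⟨e, rfl⟩ : ∃ e, d = m + e := ⟨d - m, by omega⟩
      have e1 : (((m + e : ℕ) : ℤ) + -(m : ℤ)).toNat = e := by omega
      have e2 : 2 * (m + e) - e = m + e + m := by omega
      have e3 : (2 * (m + e)).choose (m + e + m) = (2 * (m + e)).choose e :=
        Nat.choose_symm_of_eq_add (by ring)
      rw [e1, e2, Int.natAbs_neg, Int.natAbs_natCast, Nat.add_sub_cancel_left, e3]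
      ring

lemma sum_Icc_choose_mul_sqrt (d : ℕ) {a₁ b₁ a₂ b₂ : ℝ} (ha₁ : 0 ≤ a₁) (ha₂ : 0 ≤ a₂)
    (hb₁ : 0 ≤ b₁) (hb₂ : 0 ≤ b₂) (h₁ : a₁ ^ 2 + b₁ ^ 2 = 1) (h₂ : a₂ ^ 2 + b₂ ^ 2 = 1) :
    ∑ m' ∈ Finset.Icc (-(d : ℤ)) (d : ℤ), ((2 * d).choose (d + m'.natAbs) : ℝ) *
      ((a₁ * a₂) ^ (d - m'.natAbs) *
        ((1 + (if 0 ≤ m' then 1 else -1) * b₁) *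
          (1 + (if 0 ≤ m' then 1 else -1) * b₂)) ^ m'.natAbs) =
    2 ^ d * (1 + a₁ * a₂ + b₁ * b₂) ^ d := by
  have hb₁' : b₁ ≤ 1 := by nlinarith [sq_nonneg a₁]
  have hb₂' : b₂ ≤ 1 := by nlinarith [sq_nonneg a₂]
  have hp : 0 ≤ (1 + b₁) * (1 + b₂) := by positivity
  have hq : 0 ≤ (1 - b₁) * (1 - b₂) := mul_nonneg (by linarith) (by linarith)
  have hPQ : √((1 + b₁) * (1 + b₂)) * √((1 - b₁) * (1 - b₂)) = a₁ * a₂ := by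
    rw [← Real.sqrt_mul hp, show (1 + b₁) * (1 + b₂) * ((1 - b₁) * (1 - b₂)) = (a₁ * a₂) ^ 2 by
      linear_combination (-(a₂ ^ 2)) * h₁ - (1 - b₁ ^ 2) * h₂]
    exact Real.sqrt_sq (mul_nonneg ha₁ ha₂)
  have hsum := sum_Icc_choose_mul_pow d (√((1 + b₁) * (1 + b₂))) (√((1 - b₁) * (1 - b₂)))
  rw [hPQ, add_sq, mul_assoc 2, hPQ, Real.sq_sqrt hp, Real.sq_sqrt hq] at hsum
  rw [← mul_pow, show 2 * (1 + a₁ * a₂ + b₁ * b₂) =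
    (1 + b₁) * (1 + b₂) + 2 * (a₁ * a₂) + (1 - b₁) * (1 - b₂) by ring, ← hsum]
  refine Finset.sum_congr rfl fun m' _ => ?_
  split_ifs
  · rw [Real.sq_sqrt hp, one_mul, one_mul]
  · rw [Real.sq_sqrt hq]
    ring

lemma sum_range_sign_choose {R : Type*} [CommRing R] (m : ℕ) (e b₁ b₂ : R) :
    ∑ ℓ₁ ∈ Finset.range (m + 1), ∑ ℓ₂ ∈ Finset.range (m + 1),
      e ^ (ℓ₁ + ℓ₂) * (m.choose ℓ₁ : R) * (m.choose ℓ₂ : R) * (b₁ ^ ℓ₁ * b₂ ^ ℓ₂) =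
    ((1 + e * b₁) * (1 + e * b₂)) ^ m := by
  rw [mul_pow, add_comm 1, add_comm 1, add_pow, add_pow, Finset.sum_mul_sum]
  refine Finset.sum_congr rfl fun i _ => Finset.sum_congr rfl fun j _ => ?_
  simp only [one_pow, mul_pow]
  ring

/-- The integrand of the beta function with parameters `u / 2` and `v / 2`. -/
noncomputable def betaKernel (u v : ℂ) (x : ℝ) : ℂ :=
  (x : ℂ) ^ (u / 2 - 1) * ((1 - x : ℝ) : ℂ) ^ (v / 2 - 1)

lemma ofReal_cpow_half_add {x : ℝ} (hx : 0 < x) (u : ℂ) (n : ℕ) :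
    (x : ℂ) ^ (((n : ℂ) + u) / 2 - 1) = (x : ℂ) ^ (u / 2 - 1) * ((√x : ℝ) : ℂ) ^ n := by
  have hx' : (x : ℂ) ≠ 0 := Complex.ofReal_ne_zero.mpr hx.ne'
  rw [show ((n : ℂ) + u) / 2 - 1 = (u / 2 - 1) + (1 / 2 : ℂ) * n by ring,
    Complex.cpow_add _ _ hx', Complex.cpow_mul_nat, Real.sqrt_eq_rpow,
    Complex.ofReal_cpow hx.le]
  push_cast
  rfl

lemma betaKernel_mul_sqrt_pow (u v : ℂ) (n l : ℕ) {x : ℝ} (hx : x ∈ Set.Ioo (0 : ℝ) 1) :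
    (x : ℂ) ^ (((n : ℂ) + u) / 2 - 1) * (1 - (x : ℂ)) ^ (((l : ℂ) + v) / 2 - 1) =
      betaKernel u v x * (((√x : ℝ) : ℂ) ^ n * ((√(1 - x) : ℝ) : ℂ) ^ l) := by
  rw [show (1 - (x : ℂ)) = ((1 - x : ℝ) : ℂ) by push_cast; rfl, ofReal_cpow_half_add hx.1,
    ofReal_cpow_half_add (sub_pos.mpr hx.2), betaKernel]
  ring

lemma re_natCast_add_half_pos {u : ℂ} (hu : 0 < u.re) (n : ℕ) : 0 < (((n : ℂ) + u) / 2).re := by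
  rw [show ((n : ℂ) + u) / 2 = ((1 / 2 : ℝ) : ℂ) * ((n : ℂ) + u) by push_cast; ring,
    Complex.re_ofReal_mul, Complex.add_re, Complex.natCast_re]
  positivity

lemma integrableOn_betaKernel_mul {u v : ℂ} (hu : 0 < u.re) (hv : 0 < v.re) (n l : ℕ) :
    IntegrableOn (fun x : ℝ => betaKernel u v x *
      (((√x : ℝ) : ℂ) ^ n * ((√(1 - x) : ℝ) : ℂ) ^ l)) (Set.Ioo 0 1) := by
  have h := Complex.betaIntegral_convergent (re_natCast_add_half_pos hu n)
    (re_natCast_add_half_pos hv l)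
  rw [intervalIntegrable_iff_integrableOn_Ioo_of_le zero_le_one] at h
  exact h.congr_fun (fun x hx => betaKernel_mul_sqrt_pow u v n l hx) measurableSet_Ioo

lemma cBeta_eq_integral {u v : ℂ} (hu : 0 < u.re) (hv : 0 < v.re) (n l : ℕ) :
    cBeta (((n : ℂ) + u) / 2) (((l : ℂ) + v) / 2) =
      ∫ x in Set.Ioo (0 : ℝ) 1, betaKernel u v x *
        (((√x : ℝ) : ℂ) ^ n * ((√(1 - x) : ℝ) : ℂ) ^ l) := by
  rw [cBeta, ← Complex.betaIntegral_eq_Gamma_mul_div _ _ (re_natCast_add_half_pos hu n)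
    (re_natCast_add_half_pos hv l), Complex.betaIntegral,
    intervalIntegral.integral_of_le zero_le_one, integral_Ioc_eq_integral_Ioo]
  exact setIntegral_congr_fun measurableSet_Ioo fun x hx => betaKernel_mul_sqrt_pow u v n l hx

/-- The pointwise identity behind the integral formula. -/
lemma sum_kernels_eq (d : ℕ) (K₁ K₂ : ℂ) {x₁ x₂ : ℝ}
    (hx₁ : x₁ ∈ Set.Ioo (0 : ℝ) 1) (hx₂ : x₂ ∈ Set.Ioo (0 : ℝ) 1) :
    ∑ m' ∈ Finset.Icc (-(d : ℤ)) (d : ℤ),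
      ∑ ℓ₁ ∈ Finset.range (m'.natAbs + 1), ∑ ℓ₂ ∈ Finset.range (m'.natAbs + 1),
        (((2 * d).choose (d + m'.natAbs) : ℂ) * ((if 0 ≤ m' then (1 : ℂ) else -1) ^ (ℓ₁ + ℓ₂) *
          ((m'.natAbs).choose ℓ₁ : ℂ) * ((m'.natAbs).choose ℓ₂ : ℂ))) *
            ((K₁ * (((√x₁ : ℝ) : ℂ) ^ (d - m'.natAbs) * ((√(1 - x₁) : ℝ) : ℂ) ^ ℓ₁)) *
              (K₂ * (((√x₂ : ℝ) : ℂ) ^ (d - m'.natAbs) * ((√(1 - x₂) : ℝ) : ℂ) ^ ℓ₂))) =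
    (2 : ℂ) ^ d * (K₁ * K₂ *
      ((1 + √(x₁ * x₂) + √(1 - x₁) * √(1 - x₂) : ℝ) : ℂ) ^ d) := by
  have h := sum_Icc_choose_mul_sqrt d (Real.sqrt_nonneg x₁) (Real.sqrt_nonneg x₂)
    (Real.sqrt_nonneg (1 - x₁)) (Real.sqrt_nonneg (1 - x₂))
    (by rw [Real.sq_sqrt hx₁.1.le, Real.sq_sqrt (sub_pos.mpr hx₁.2).le]; ring)
    (by rw [Real.sq_sqrt hx₂.1.le, Real.sq_sqrt (sub_pos.mpr hx₂.2).le]; ring)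
  rw [← Real.sqrt_mul hx₁.1.le] at h
  rw [mul_left_comm, ← Complex.ofReal_pow, show (2 : ℂ) ^ d = ((2 ^ d : ℝ) : ℂ) by push_cast; rfl,
    ← Complex.ofReal_mul, ← h, Complex.ofReal_sum, Finset.mul_sum]
  refine Finset.sum_congr rfl fun m' _ => ?_
  rw [Real.sqrt_mul hx₁.1.le]
  push_cast
  rw [← sum_range_sign_choose]
  simp only [Finset.mul_sum, apply_ite Complex.ofReal, Complex.ofReal_neg, Complex.ofReal_one]
  refine Finset.sum_congr rfl fun i _ => Finset.sum_congr rfl fun j _ => ?_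
  ring

/-- The sum of products of beta functions appearing in the proof of Stade's formula equals an
elementary two-dimensional integral. -/
theorem beta_sum_eq_elementary_integral (d : ℕ) (hd : 2 ≤ d) (s₁ s₂ t r r' : ℂ)
    (h1 : 0 < (s₁ + 2 * r).re) (h2 : 0 < (s₂ - 2 * r).re)
    (h3 : 0 < (2 * t - s₁ + 2 * r').re) (h4 : 0 < (t - s₂ - 2 * r').re) :
    (∑ m' ∈ Finset.Icc (-(d : ℤ)) (d : ℤ),
      ((2 * d).choose (d + m'.natAbs) : ℂ) *
        ∑ ℓ₁ ∈ Finset.range (m'.natAbs + 1), ∑ ℓ₂ ∈ Finset.range (m'.natAbs + 1),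
          (if 0 ≤ m' then (1 : ℂ) else -1) ^ (ℓ₁ + ℓ₂) *
            ((m'.natAbs).choose ℓ₁ : ℂ) * ((m'.natAbs).choose ℓ₂ : ℂ) *
              cBeta (((d : ℂ) - (m'.natAbs : ℂ) + s₁ + 2 * r) / 2) (((ℓ₁ : ℂ) + s₂ - 2 * r) / 2) *
                cBeta (((d : ℂ) - (m'.natAbs : ℂ) + 2 * t - s₁ + 2 * r') / 2)
                  (((ℓ₂ : ℂ) + t - s₂ - 2 * r') / 2)) =
    (2 : ℂ) ^ d *
      ∫ x₁ in Set.Ioo (0 : ℝ) 1, ∫ x₂ in Set.Ioo (0 : ℝ) 1,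
        ((x₁ : ℂ)) ^ ((s₁ + 2 * r) / 2 - 1) * (((1 - x₁ : ℝ)) : ℂ) ^ ((s₂ - 2 * r) / 2 - 1) *
          ((x₂ : ℂ)) ^ ((2 * t - s₁ + 2 * r') / 2 - 1) *
            (((1 - x₂ : ℝ)) : ℂ) ^ ((t - s₂ - 2 * r') / 2 - 1) *
              (((1 + Real.sqrt (x₁ * x₂) + Real.sqrt (1 - x₁) * Real.sqrt (1 - x₂) : ℝ)) : ℂ) ^ d := by
  have e₁ : ∀ x₁ ∈ Set.Ioo (0 : ℝ) 1, ∀ x₂ ∈ Set.Ioo (0 : ℝ) 1, _ := fun x₁ hx₁ x₂ hx₂ =>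
    sum_kernels_eq d (betaKernel (s₁ + 2 * r) (s₂ - 2 * r) x₁)
      (betaKernel (2 * t - s₁ + 2 * r') (t - s₂ - 2 * r') x₂) hx₁ hx₂
  simp_rw [← integral_const_mul]
  have hint := fun n l k j : ℕ => Integrable.mul_prod (integrableOn_betaKernel_mul h1 h2 n l)
    (integrableOn_betaKernel_mul h3 h4 k j)
  symm
  rw [setIntegral_congr_fun measurableSet_Ioo fun x₁ hx₁ =>
    setIntegral_congr_fun measurableSet_Ioo fun x₂ hx₂ => Eq.trans (by
      simp only [betaKernel]; ring) (e₁ x₁ hx₁ x₂ hx₂).symm]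
  rw [integral_integral]
  swap
  · exact integrable_finsetSum _ fun m' _ => integrable_finsetSum _ fun i _ =>
      integrable_finsetSum _ fun j _ => (hint _ _ _ _).const_mul _
  rw [integral_finsetSum _ fun m' _ => integrable_finsetSum _ fun i _ =>
      integrable_finsetSum _ fun j _ => (hint _ _ _ _).const_mul _]
  refine Finset.sum_congr rfl fun m' hm => ?_
  have hle : m'.natAbs ≤ d := by
    rw [Finset.mem_Icc] at hm
    omega
  rw [integral_finsetSum _ fun i _ => integrable_finsetSum _ fun j _ =>
    (hint _ _ _ _).const_mul _, Finset.mul_sum]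
  refine Finset.sum_congr rfl fun i _ => ?_
  rw [integral_finsetSum _ fun j _ => (hint _ _ _ _).const_mul _, Finset.mul_sum]
  refine Finset.sum_congr rfl fun j _ => ?_
  have c₁ := cBeta_eq_integral h1 h2 (d - m'.natAbs) i
  have c₂ := cBeta_eq_integral h3 h4 (d - m'.natAbs) j
  rw [Nat.cast_sub hle] at c₁ c₂
  simp only [← add_assoc, ← add_sub_assoc] at c₁ c₂
  rw [integral_const_mul, c₁, c₂, mul_assoc (_ * _) (∫ _ in _, _), ← integral_prod_mul, mul_assoc]
end
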